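/- arXiv:2312.09774 — 2 statements merged into one kernel-verified Lean document; each statement's English description precedes it below -/
import Mathlib

section
/- Suppose δ ≥ 1 is an integer such that ord_0(f_h) ≤ δ for every h ∈ GL_{N+1}(k) (i.e. the multiplicity of H at every point of H(k) is at most δ), and s ≥ −1 is an integer such that the Krull dimension of k[X_0,…,X_N]/J is at most s+1 (i.e. dim(H_sing) ≤ s). If d > δ·min(N+1, s+3), then for every g ∈ GL_{N+1}(k) and every nonzero α = (α_0,…,α_N) ∈ ℤ^{N+1} with Σ_{i=0}^N α_i = 0, one has deg_α(F∘g) > 0; that is, F satisfies the Hilbert–Mumford criterion for stability, so the hypersurface H is stable. -/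
open MvPolynomial

/-- The `α`-degree of a multivariate polynomial `G`: the maximum of `∑ i, m i * α i`
over the monomials `X^m` occurring in `G` with nonzero coefficient (0 if `G = 0`). -/
noncomputable def adeg {k : Type*} [CommSemiring k] {n : ℕ} (α : Fin n → ℤ)
    (G : MvPolynomial (Fin n) k) : ℤ :=
  if h : G.support.Nonempty then G.support.sup' h (fun m => ∑ i, (m i : ℤ) * α i) else 0

/-- `F ∘ g`: the polynomial obtained from `F` by the substitution `X i ↦ ∑ j, g i j • X j`. -/
noncomputable def substGL {k : Type*} [CommRing k] {n : ℕ}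
    (g : Matrix (Fin n) (Fin n) k) (F : MvPolynomial (Fin n) k) :
    MvPolynomial (Fin n) k :=
  aeval (fun i => ∑ j, C (g i j) * X j) F

/-- Dehomogenization with respect to the last variable:
`G(X_0, …, X_N) ↦ G(x_0, …, x_{N-1}, 1)`. -/
noncomputable def dehom {k : Type*} [CommRing k] {N : ℕ}
    (G : MvPolynomial (Fin (N+1)) k) : MvPolynomial (Fin N) k :=
  aeval (fun i : Fin (N+1) => if h : (i : ℕ) < N then X ⟨i, h⟩ else 1) G

/-- `ord_0 f`: the minimal total degree of a monomial occurring in `f`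
with nonzero coefficient (0 if `f = 0`). -/
noncomputable def ord0 {k : Type*} [CommSemiring k] {N : ℕ}
    (f : MvPolynomial (Fin N) k) : ℕ :=
  if h : f.support.Nonempty then f.support.inf' h (fun m => ∑ i, m i) else 0

/-- The ideal generated by `F` and its partial derivatives, defining the singular
locus `H_sing` of the hypersurface `H = {F = 0}`. -/
noncomputable def jacobianIdeal {k : Type*} [CommRing k] {N : ℕ}
    (F : MvPolynomial (Fin (N+1)) k) : Ideal (MvPolynomial (Fin (N+1)) k) :=
  Ideal.span ({F} ∪ Set.range (fun i => pderiv i F))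

open Finset in
/-- Layer-cake inequality: if every positive level `c` is exceeded by at most `e` more entries of `α`
than those that lie below `-c`, then no entry of `α` is much more negative than its maximum. -/
theorem sum_ne_zero_of_card_level_le {ι : Type*} [Fintype ι] (α : ι → ℤ) (e : ℕ) (M : ℤ)
    (hM : 0 < M) (hmax : ∀ i, α i ≤ M)
    (hcount : ∀ c, 0 < c → #{i | c ≤ α i} ≤ #{i | α i ≤ -c} + e)
    (i₀ : ι) (hi₀ : α i₀ < -((e + 1) * M)) : ∑ i, α i ≠ 0 := by
  classical
  intro hsum
  have hle : ∑ c ∈ Icc 1 M, ∑ i, (if c ≤ α i then (1 : ℤ) else 0) ≤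
      ∑ c ∈ Icc 1 M, (∑ i, (if α i ≤ -c then (1 : ℤ) else 0) + e) := by
    refine sum_le_sum fun c hc => ?_
    have h := hcount c (by simp at hc; lia)
    rw [sum_boole, sum_boole]
    exact_mod_cast h
  rw [sum_add_distrib, sum_comm, sum_comm (s := Icc 1 M)] at hle
  simp only [sum_const, Int.card_Icc, nsmul_eq_mul] at hle
  have hup (i : ι) : ∑ c ∈ Icc 1 M, (if c ≤ α i then (1 : ℤ) else 0) = max (α i) 0 := by
    rw [sum_boole, show (Icc 1 M).filter (· ≤ α i) = Icc 1 (α i) by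
      ext c; simp; have := hmax i; lia]
    simp
  have hlow (i : ι) : ∑ c ∈ Icc 1 M, (if α i ≤ -c then (1 : ℤ) else 0) = max (min M (-α i)) 0 := by
    rw [sum_boole, show (Icc 1 M).filter (α i ≤ -·) = Icc 1 (min M (-α i)) by
      ext c; simp; lia]
    simp
  simp only [hup, hlow] at hle
  have hpt : ∑ i, (α i + if i = i₀ then -M - α i₀ else 0) ≤
      ∑ i, (max (α i) 0 - max (min M (-α i)) 0) := by
    refine sum_le_sum fun i _ => ?_
    split_ifs with h
    · subst h
      have : 0 ≤ (e : ℤ) * M := by positivity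
      have : ((e : ℤ) + 1) * M = e * M + M := by ring
      lia
    · lia
  rw [sum_add_distrib, sum_sub_distrib, hsum] at hpt
  simp only [sum_ite_eq', mem_univ, if_true] at hpt
  have : ((M + 1 - 1).toNat : ℤ) * e = e * M := by
    rw [Int.toNat_of_nonneg (by lia)]; ring
  rw [this] at hle
  have : ((e : ℤ) + 1) * M = e * M + M := by ring
  lia

section Height

variable {k σ : Type*} [Field k] [DecidableEq σ]

/-- The endomorphism of `k[X]` sending the variables in `s` to `0`. -/
noncomputable def killVars (k : Type*) {σ : Type*} [Field k] [DecidableEq σ] (s : Finset σ) :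
    MvPolynomial σ k →ₐ[k] MvPolynomial σ k :=
  aeval fun i => if i ∈ s then 0 else X i

theorem ker_killVars_lt_insert {s : Finset σ} {a : σ} (ha : a ∉ s) :
    RingHom.ker (killVars k s) < RingHom.ker (killVars k (insert a s)) := by
  have hcomp : (killVars k (insert a s)).comp (killVars k s) = killVars k (insert a s) := by
    ext1 i
    by_cases hi : i ∈ s <;> simp [killVars, hi]
  refine lt_of_le_of_ne (fun f hf => ?_) fun h => ?_
  · rw [RingHom.mem_ker] at hf ⊢
    rw [← hcomp, AlgHom.comp_apply, hf, map_zero]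
  · have hX : (X a : MvPolynomial σ k) ∈ RingHom.ker (killVars k (insert a s)) := by
      simp [RingHom.mem_ker, killVars]
    rw [← h] at hX
    simp [RingHom.mem_ker, killVars, ha] at hX

theorem card_le_height_ker_killVars (s : Finset σ) :
    (s.card : ℕ∞) ≤ (RingHom.ker (killVars k s)).height := by
  induction s using Finset.induction_on with
  | empty => simp
  | insert a s ha ih =>
    rw [Finset.card_insert_of_notMem ha, Nat.cast_add, Nat.cast_one]
    grw [ih]
    have := RingHom.ker_isPrime (killVars k s)
    have := RingHom.ker_isPrime (killVars k (insert a s))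
    exact Ideal.height_add_one_le_of_lt_of_isPrime (ker_killVars_lt_insert ha)

/-- The quotient of a polynomial ring by `r` polynomials without constant term has Krull dimension
at least the number of variables minus `r`. -/
theorem card_le_ringKrullDim_quotient_span_add_encard [Fintype σ] (A : Set (MvPolynomial σ k))
    (hA : ∀ f ∈ A, constantCoeff f = 0) :
    (Fintype.card σ : WithBot ℕ∞) ≤
      ringKrullDim (MvPolynomial σ k ⧸ Ideal.span A) + (A.encard : WithBot ℕ∞) := by
  have := RingHom.ker_isPrime (killVars k (Finset.univ : Finset σ))
  have hsub : A ⊆ RingHom.ker (killVars k (Finset.univ : Finset σ)) := fun f hf => by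
    have : killVars k (Finset.univ : Finset σ) = aeval fun _ => 0 := by simp [killVars]
    rw [SetLike.mem_coe, RingHom.mem_ker, this, aeval_zero', hA f hf, map_zero]
  refine le_trans ?_ (Ideal.height_le_ringKrullDim_quotient_add_encard A hsub)
  have h := card_le_height_ker_killVars (k := k) (Finset.univ : Finset σ)
  rw [Finset.card_univ] at h
  exact_mod_cast h

end Height

/-- Let `L` be the coordinate subspace spanned by the coordinates in `T`, and assume `L` is contained
in `{G = 0}`. Then `L` meets the singular locus of `{G = 0}` in dimension at least `#T` minus the
number of partial derivatives of `G` that do not vanish on `L`. -/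
theorem card_le_card_pderiv_notMem_add {k : Type*} [Field k] {N d e : ℕ} (hd : 2 ≤ d)
    {G : MvPolynomial (Fin (N + 1)) k} (hG : G.IsHomogeneous d)
    (hdim : ringKrullDim (MvPolynomial (Fin (N + 1)) k ⧸ jacobianIdeal G) ≤ (e : WithBot ℕ∞))
    (T S : Finset (Fin (N + 1))) (hT : G ∈ Ideal.span (X '' (↑Tᶜ : Set (Fin (N + 1)))))
    (hS : ∀ i ∉ S, pderiv i G ∈ Ideal.span (X '' (↑Tᶜ : Set (Fin (N + 1))))) :
    T.card ≤ S.card + e := by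
  classical
  set A : Finset (MvPolynomial (Fin (N + 1)) k) := Tᶜ.image X ∪ S.image fun i => pderiv i G with hA
  have hXA : Ideal.span (X '' (↑Tᶜ : Set (Fin (N + 1)))) ≤
      Ideal.span (A : Set (MvPolynomial (Fin (N + 1)) k)) := by
    refine Ideal.span_mono ?_
    simp [hA]
  have hJ : jacobianIdeal G ≤ Ideal.span (A : Set (MvPolynomial (Fin (N + 1)) k)) := by
    refine Ideal.span_le.2 ?_
    rintro _ (rfl | ⟨i, rfl⟩)
    · exact hXA hT
    · by_cases hi : i ∈ S
      · refine Ideal.subset_span ?_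
        rw [hA, Finset.coe_union]
        exact Or.inr (by simpa using ⟨i, hi, rfl⟩)
      · exact hXA (hS i hi)
  have hconst {n : ℕ} (hn : 0 < n) {f : MvPolynomial (Fin (N + 1)) k} (hf : f.IsHomogeneous n) :
      constantCoeff f = 0 := by
    refine hf.coeff_eq_zero ?_
    simpa using hn.ne
  have h := card_le_ringKrullDim_quotient_span_add_encard
    (A : Set (MvPolynomial (Fin (N + 1)) k)) (by
      intro f hf
      simp only [hA, Finset.coe_union, Finset.coe_image, Set.mem_union, Set.mem_image] at hf
      obtain ⟨i, -, rfl⟩ | ⟨i, -, rfl⟩ := hf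
      · simp
      · exact hconst (n := d - 1) (by lia) hG.pderiv)
  have hdim' : ringKrullDim (MvPolynomial (Fin (N + 1)) k ⧸
      Ideal.span (A : Set (MvPolynomial (Fin (N + 1)) k))) ≤ (e : WithBot ℕ∞) :=
    (ringKrullDim_le_of_surjective _ (Ideal.Quotient.factor_surjective hJ)).trans hdim
  have hcard : A.card ≤ (N + 1 - T.card) + S.card := by
    refine (Finset.card_union_le _ _).trans (add_le_add ?_ Finset.card_image_le)
    refine Finset.card_image_le.trans ?_
    simp [Finset.card_compl]
  have hTN : T.card ≤ N + 1 := by simpa using T.card_le_univ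
  grw [hdim'] at h
  rw [Set.encard_coe_eq_coe_finsetCard, Fintype.card_fin] at h
  have : N + 1 ≤ e + A.card := by exact_mod_cast h
  lia

section Substitution

variable {k : Type*} [CommRing k] {n : ℕ}

theorem substGL_substGL (g h : Matrix (Fin n) (Fin n) k) (F : MvPolynomial (Fin n) k) :
    substGL h (substGL g F) = substGL (g * h) F := by
  have : (aeval fun i => ∑ j, C (h i j) * X j).comp (aeval fun i => ∑ j, C (g i j) * X j) =
      (aeval fun i => ∑ j, C ((g * h) i j) * X j :
        MvPolynomial (Fin n) k →ₐ[k] MvPolynomial (Fin n) k) := by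
    ext1 i
    simp only [AlgHom.comp_apply, aeval_X, map_sum, map_mul, aeval_C, algebraMap_eq,
      Matrix.mul_apply, Finset.mul_sum, Finset.sum_mul, mul_assoc]
    exact Finset.sum_comm
  exact DFunLike.congr_fun this F

theorem substGL_one (F : MvPolynomial (Fin n) k) : substGL 1 F = F := by
  have : (aeval fun i => ∑ j, C ((1 : Matrix (Fin n) (Fin n) k) i j) * X j) =
      AlgHom.id k (MvPolynomial (Fin n) k) := by
    ext1 i
    simp [Matrix.one_apply]
  exact DFunLike.congr_fun this F

theorem substGL_inv_substGL (g : Matrix.GeneralLinearGroup (Fin n) k)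
    (F : MvPolynomial (Fin n) k) :
    substGL (↑g⁻¹ : Matrix (Fin n) (Fin n) k) (substGL (↑g) F) = F := by
  rw [substGL_substGL, Units.mul_inv, substGL_one]

theorem substGL_substGL_inv (g : Matrix.GeneralLinearGroup (Fin n) k)
    (F : MvPolynomial (Fin n) k) :
    substGL (↑g) (substGL (↑g⁻¹ : Matrix (Fin n) (Fin n) k) F) = F := by
  rw [substGL_substGL, Units.inv_mul, substGL_one]

theorem pderiv_substGL (g : Matrix (Fin n) (Fin n) k) (F : MvPolynomial (Fin n) k) (j : Fin n) :
    pderiv j (substGL g F) = ∑ i, C (g i j) * substGL g (pderiv i F) := by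
  unfold substGL
  induction F using MvPolynomial.induction_on with
  | C a => simp
  | add p q hp hq => simp only [map_add, hp, hq, mul_add, Finset.sum_add_distrib]
  | mul_X p l hp =>
    have hl : pderiv j (∑ m, C (g l m) * X m : MvPolynomial (Fin n) k) = C (g l j) := by
      simp [pderiv_X, Pi.single_apply]
    simp only [map_mul, pderiv_mul, hp, aeval_X, hl, map_add, mul_add, Finset.sum_add_distrib,
      Finset.sum_mul, mul_assoc]
    congr 1
    simp [pderiv_X, Pi.single_apply, mul_comm]

theorem MvPolynomial.IsHomogeneous.substGL {d : ℕ} {F : MvPolynomial (Fin n) k}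
    (hF : F.IsHomogeneous d) (g : Matrix (Fin n) (Fin n) k) :
    (_root_.substGL g F).IsHomogeneous d := by
  rw [← one_mul d]
  exact hF.aeval _ fun i => .sum _ _ _ fun j _ => (isHomogeneous_X k j).C_mul _

theorem substGL_ne_zero (g : Matrix.GeneralLinearGroup (Fin n) k) {F : MvPolynomial (Fin n) k}
    (hF : F ≠ 0) : substGL (↑g) F ≠ 0 := fun h => hF <| by
  rw [← substGL_inv_substGL g F, h, substGL, map_zero]

theorem substGL_submatrix_perm (g : Matrix (Fin n) (Fin n) k) (σ : Equiv.Perm (Fin n))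
    (F : MvPolynomial (Fin n) k) :
    substGL (g.submatrix id σ) F = rename σ.symm (substGL g F) := by
  have : (aeval fun i => ∑ j, C (g.submatrix id σ i j) * X j) =
      (rename σ.symm).comp (aeval fun i => ∑ j, C (g i j) * X j :
        MvPolynomial (Fin n) k →ₐ[k] MvPolynomial (Fin n) k) := by
    ext1 i
    simp only [AlgHom.comp_apply, aeval_X, map_sum, map_mul, rename_C, rename_X]
    exact Fintype.sum_equiv σ _ _ fun j => by simp
  exact DFunLike.congr_fun this F

/-- Permuting the columns of an invertible matrix. -/
def permCols (g : Matrix.GeneralLinearGroup (Fin n) k) (σ : Equiv.Perm (Fin n)) :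
    Matrix.GeneralLinearGroup (Fin n) k where
  val := (g : Matrix (Fin n) (Fin n) k).submatrix id σ
  inv := (↑g⁻¹ : Matrix (Fin n) (Fin n) k).submatrix σ id
  val_inv := by rw [Matrix.submatrix_mul_equiv, Units.mul_inv, Matrix.submatrix_id_id]
  inv_val := by
    rw [← Matrix.submatrix_mul _ _ _ _ _ Function.bijective_id, Units.inv_mul,
      Matrix.submatrix_one_equiv]

theorem substGL_pderiv_mem_jacobianIdeal {N : ℕ}
    (g : Matrix.GeneralLinearGroup (Fin (N + 1)) k) (F : MvPolynomial (Fin (N + 1)) k)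
    (i : Fin (N + 1)) : substGL (↑g) (pderiv i F) ∈ jacobianIdeal (substGL (↑g) F) := by
  have h := pderiv_substGL (↑g⁻¹ : Matrix (Fin (N + 1)) (Fin (N + 1)) k) (substGL (↑g) F) i
  rw [substGL_inv_substGL] at h
  have h' : substGL (↑g) (pderiv i F) =
      ∑ l, C ((↑g⁻¹ : Matrix (Fin (N + 1)) (Fin (N + 1)) k) l i) *
        pderiv l (substGL (↑g) F) := by
    rw [h]
    conv_lhs => rw [substGL, map_sum]
    refine Finset.sum_congr rfl fun l _ => ?_
    rw [map_mul, aeval_C, algebraMap_eq]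
    congr 1
    exact substGL_substGL_inv g _
  rw [h']
  exact Ideal.sum_mem _ fun l _ =>
    Ideal.mul_mem_left _ _ (Ideal.subset_span (Or.inr ⟨l, rfl⟩))

theorem ringKrullDim_quotient_jacobianIdeal_substGL_le {N : ℕ}
    (g : Matrix.GeneralLinearGroup (Fin (N + 1)) k) (F : MvPolynomial (Fin (N + 1)) k) :
    ringKrullDim (MvPolynomial (Fin (N + 1)) k ⧸ jacobianIdeal (substGL (↑g) F)) ≤
      ringKrullDim (MvPolynomial (Fin (N + 1)) k ⧸ jacobianIdeal F) := by
  obtain ⟨φ, hφ⟩ : ∃ φ : MvPolynomial (Fin (N + 1)) k →+* MvPolynomial (Fin (N + 1)) k,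
      ∀ f, φ f = substGL (↑g) f := ⟨(aeval _ : _ →ₐ[k] _).toRingHom, fun _ => rfl⟩
  have hsurj : Function.Surjective φ := fun f => ⟨_, (hφ _).trans (substGL_substGL_inv g f)⟩
  have hle : jacobianIdeal F ≤ (jacobianIdeal (substGL (↑g) F)).comap φ := by
    refine Ideal.span_le.2 (Set.union_subset ?_ ?_)
    · rw [Set.singleton_subset_iff, SetLike.mem_coe, Ideal.mem_comap, hφ]
      exact Ideal.subset_span (Or.inl rfl)
    · rintro _ ⟨i, rfl⟩
      rw [SetLike.mem_coe, Ideal.mem_comap, hφ]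
      exact substGL_pderiv_mem_jacobianIdeal g F i
  exact ringKrullDim_le_of_surjective _ (Ideal.quotientMap_surjective (H := hle) hsurj)

end Substitution

/-- The order at the origin of the dehomogenization of a form `G` of degree `d` is `d` minus the
largest exponent of the last variable in `G`. -/
theorem exists_mem_support_of_ord0_dehom_le {k : Type*} [Field k] {N d δ : ℕ}
    {G : MvPolynomial (Fin (N + 1)) k} (hG0 : G ≠ 0) (hG : G.IsHomogeneous d)
    (h : ord0 (dehom G) ≤ δ) : ∃ m ∈ G.support, d ≤ m (Fin.last N) + δ := by
  classical
  let r (m : Fin (N + 1) →₀ ℕ) : Fin N →₀ ℕ := Finsupp.equivFunOnFinite.symm fun i => m i.castSucc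
  have hdeg {m : Fin (N + 1) →₀ ℕ} (hm : m ∈ G.support) : ∑ i, r m i + m (Fin.last N) = d := by
    have := hG (mem_support_iff.1 hm)
    rw [Finsupp.weight_apply, Finsupp.sum_fintype _ _ (by simp), Fin.sum_univ_castSucc] at this
    simpa [r] using this
  have hr {m m' : Fin (N + 1) →₀ ℕ} (hm : m ∈ G.support) (hm' : m' ∈ G.support)
      (hmm : r m = r m') : m = m' := by
    ext i
    induction i using Fin.lastCases with
    | last => have := hdeg hm; have := hdeg hm'; rw [hmm] at *; lia
    | cast i => exact DFunLike.congr_fun hmm i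
  have hf : dehom G = ∑ m ∈ G.support, monomial (r m) (coeff m G) := by
    rw [dehom, aeval_def, eval₂_eq']
    refine Finset.sum_congr rfl fun m _ => ?_
    rw [Fin.prod_univ_castSucc, monomial_eq, Finsupp.prod_fintype _ _ (by simp)]
    simp [r]
  have hcoeff {m : Fin (N + 1) →₀ ℕ} (hm : m ∈ G.support) :
      coeff (r m) (dehom G) = coeff m G := by
    rw [hf, coeff_sum, Finset.sum_eq_single_of_mem m hm, coeff_monomial, if_pos rfl]
    intro m' hm' hne
    rw [coeff_monomial, if_neg fun h => hne (hr hm' hm h)]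
  have hne : (dehom G).support.Nonempty := by
    obtain ⟨m, hm⟩ := support_nonempty.2 hG0
    exact ⟨r m, by rw [mem_support_iff, hcoeff hm]; exact mem_support_iff.1 hm⟩
  rw [ord0, dif_pos hne] at h
  obtain ⟨b, hb, hbeq⟩ := Finset.exists_mem_eq_inf' hne fun m : Fin N →₀ ℕ => ∑ i, m i
  rw [hbeq] at h
  rw [mem_support_iff, hf, coeff_sum] at hb
  obtain ⟨m, hm, hmb⟩ := Finset.exists_ne_zero_of_sum_ne_zero hb
  rw [coeff_monomial] at hmb
  obtain rfl : r m = b := by by_contra hrb; exact hmb (if_neg hrb)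
  exact ⟨m, hm, by have := hdeg hm; lia⟩

/-- The multiplicity at the `j`-th coordinate point bounds the exponent of `X j` from below. -/
theorem exists_mem_support_substGL {k : Type*} [Field k] {N d δ : ℕ}
    {F : MvPolynomial (Fin (N + 1)) k} (hF0 : F ≠ 0) (hF : F.IsHomogeneous d)
    (hmult : ∀ h : Matrix.GeneralLinearGroup (Fin (N + 1)) k,
      ord0 (dehom (substGL (↑h) F)) ≤ δ)
    (g : Matrix.GeneralLinearGroup (Fin (N + 1)) k) (j : Fin (N + 1)) :
    ∃ m ∈ (substGL (↑g) F).support, d ≤ m j + δ := by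
  classical
  let σ := Equiv.swap j (Fin.last N)
  obtain ⟨m, hm, hmd⟩ := exists_mem_support_of_ord0_dehom_le
    (substGL_ne_zero (permCols g σ) hF0) (hF.substGL _) (hmult (permCols g σ))
  change m ∈ (substGL ((g : Matrix (Fin (N + 1)) (Fin (N + 1)) k).submatrix id σ) F).support at hm
  rw [substGL_submatrix_perm, support_rename_of_injective σ.symm.injective] at hm
  obtain ⟨m', hm', rfl⟩ := Finset.mem_image.1 hm
  have h := Finsupp.mapDomain_apply σ.symm.injective m' j
  rw [show σ.symm j = Fin.last N by simp [σ]] at h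
  exact ⟨m', hm', h ▸ hmd⟩

theorem weight_le_adeg {k : Type*} [CommSemiring k] {n : ℕ} (α : Fin n → ℤ)
    {G : MvPolynomial (Fin n) k} {m : Fin n →₀ ℕ} (hm : m ∈ G.support) :
    ∑ i, (m i : ℤ) * α i ≤ adeg α G := by
  rw [adeg, dif_pos ⟨m, hm⟩]
  exact Finset.le_sup' (fun m : Fin n →₀ ℕ => ∑ i, (m i : ℤ) * α i) hm

theorem sum_eq_of_mem_support {k : Type*} [CommSemiring k] {n d : ℕ}
    {G : MvPolynomial (Fin n) k} (hG : G.IsHomogeneous d) {m : Fin n →₀ ℕ}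
    (hm : m ∈ G.support) : ∑ i, m i = d := by
  have := hG (mem_support_iff.1 hm)
  rw [Finsupp.weight_apply, Finsupp.sum_fintype _ _ (by simp)] at this
  simpa using this

/-- A monomial in which `X j` has exponent at least `d - δ` forces, when its weight is nonpositive,
some entry of `α` to be very negative. -/
theorem exists_lt_neg_mul_of_weight_nonpos {n d δ c : ℕ} (α : Fin n → ℤ) (m : Fin n → ℕ)
    (hm : ∑ i, m i = d) (j : Fin n) (hj : 0 < α j) (hmj : d ≤ m j + δ) (hd : δ * (c + 1) < d)
    (hw : ∑ i, (m i : ℤ) * α i ≤ 0) : ∃ i, α i < -(c * α j) := by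
  by_contra! hα
  have hrest : ∑ i ∈ Finset.univ.erase j, (m i : ℤ) * -(c * α j) ≤
      ∑ i ∈ Finset.univ.erase j, (m i : ℤ) * α i :=
    Finset.sum_le_sum fun i _ => mul_le_mul_of_nonneg_left (hα i) (by positivity)
  rw [← Finset.sum_mul] at hrest
  rw [← Finset.add_sum_erase _ _ (Finset.mem_univ j)] at hw hm
  have hm' : (m j : ℤ) + ∑ i ∈ Finset.univ.erase j, (m i : ℤ) = d := by exact_mod_cast hm
  have hmj' : (d : ℤ) ≤ m j + δ := by exact_mod_cast hmj
  have hd' : (δ : ℤ) * (c + 1) < d := by exact_mod_cast hd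
  set R : ℤ := ∑ i ∈ Finset.univ.erase j, (m i : ℤ)
  have h1 : R * c ≤ δ * c := mul_le_mul_of_nonneg_right (by lia) (by positivity)
  have h2 : 0 < ((m j : ℤ) - R * c) * α j := mul_pos (by linarith) hj
  linarith

/-- If all weights of a form `G` are nonpositive, then each positive level of `α` is exceeded by few
entries compared with those below the opposite level, in terms of the dimension of the singular
locus. -/
theorem card_level_le_of_adeg_nonpos {k : Type*} [Field k] {N d e : ℕ} (hd : 2 ≤ d)
    {G : MvPolynomial (Fin (N + 1)) k} (hG : G.IsHomogeneous d)
    (hdim : ringKrullDim (MvPolynomial (Fin (N + 1)) k ⧸ jacobianIdeal G) ≤ (e : WithBot ℕ∞))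
    (α : Fin (N + 1) → ℤ) (hα : adeg α G ≤ 0) (c : ℤ) (hc : 0 < c) :
    Finset.card {i | c ≤ α i} ≤ Finset.card {i | α i ≤ -c} + e := by
  classical
  have hlevel {m : Fin (N + 1) →₀ ℕ} (hm : ∀ i ∉ ({i | c ≤ α i} : Finset _), m i = 0) :
      (∑ i, m i : ℕ) * c ≤ ∑ i, (m i : ℤ) * α i := by
    push_cast
    rw [Finset.sum_mul]
    refine Finset.sum_le_sum fun i _ => ?_
    by_cases hi : c ≤ α i
    · exact mul_le_mul_of_nonneg_left hi (by positivity)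
    · simp [hm i (by simpa using hi)]
  refine card_le_card_pderiv_notMem_add hd hG hdim _ _ ?_ fun i hi => ?_
  · refine mem_ideal_span_X_image.2 fun m hm => ?_
    by_contra! h
    have h1 := hlevel (m := m) fun i hi => h i (by simpa using hi)
    rw [sum_eq_of_mem_support hG hm] at h1
    have := weight_le_adeg α hm
    have : 0 < (d : ℤ) * c := by positivity
    lia
  · refine mem_ideal_span_X_image.2 fun m hm => ?_
    by_contra! h
    have h1 := hlevel (m := m) fun i hi => h i (by simpa using hi)
    rw [sum_eq_of_mem_support hG.pderiv hm] at h1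
    rw [mem_support_iff, coeff_pderiv] at hm
    have h2 := weight_le_adeg α (mem_support_iff.2 (left_ne_zero_of_mul hm))
    simp only [Finsupp.add_apply, Nat.cast_add, add_mul, Finset.sum_add_distrib,
      Finsupp.single_apply] at h2
    simp at h2 hi
    have : c ≤ ((d - 1 : ℕ) : ℤ) * c := le_mul_of_one_le_left hc.le (by lia)
    lia

/-- If the multiplicity of `H = {F = 0}` at every point is at most `δ`,
`dim H_sing ≤ s`, and `d > δ · min(N+1, s+3)`, then `F` satisfies the
Hilbert–Mumford criterion for stability, i.e. `H` is stable. -/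
theorem stable_of_deg_gt_mult_mul_min {k : Type*} [Field k] [IsAlgClosed k]
    {N d : ℕ} (hN : 1 ≤ N) (hd : 2 ≤ d)
    (F : MvPolynomial (Fin (N+1)) k) (hF0 : F ≠ 0) (hFhom : F.IsHomogeneous d)
    (δ : ℕ) (hδ : 1 ≤ δ)
    (hmult : ∀ h : Matrix.GeneralLinearGroup (Fin (N+1)) k,
      ord0 (dehom (substGL (↑h) F)) ≤ δ)
    (s : ℤ) (hs : -1 ≤ s)
    (hsing : ringKrullDim (MvPolynomial (Fin (N+1)) k ⧸ jacobianIdeal F)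
      ≤ ((s+1).toNat : WithBot ℕ∞))
    (hdeg : (δ : ℤ) * min ((N : ℤ) + 1) (s + 3) < (d : ℤ)) :
    ∀ g : Matrix.GeneralLinearGroup (Fin (N+1)) k, ∀ α : Fin (N+1) → ℤ,
      α ≠ 0 → (∑ i, α i) = 0 → 0 < adeg α (substGL (↑g) F) := by
  intro g α hα hsum
  by_contra! hneg
  obtain ⟨j, -, hj⟩ := Finset.exists_max_image Finset.univ α Finset.univ_nonempty
  replace hj (i : Fin (N + 1)) : α i ≤ α j := hj i (Finset.mem_univ i)
  have hjpos : 0 < α j := by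
    by_contra! h
    refine hα (funext fun i => ?_)
    exact (Finset.sum_eq_zero_iff_of_nonpos fun i _ => (hj i).trans h).1 hsum i (Finset.mem_univ i)
  have hG := hFhom.substGL (g : Matrix (Fin (N + 1)) (Fin (N + 1)) k)
  obtain ⟨m, hm, hmj⟩ := exists_mem_support_substGL hF0 hFhom hmult g j
  have hentry {c : ℕ} (hc : δ * (c + 1) < d) : ∃ i, α i < -(c * α j) :=
    exists_lt_neg_mul_of_weight_nonpos α m (sum_eq_of_mem_support hG hm) j hjpos hmj hc
      ((weight_le_adeg α hm).trans hneg)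
  rcases le_total ((N : ℤ) + 1) (s + 3) with h | h
  · rw [min_eq_left h] at hdeg
    obtain ⟨i, hi⟩ := hentry (c := N) (by exact_mod_cast hdeg)
    have h1 : ∑ l ∈ Finset.univ.erase i, α l ≤ ∑ l ∈ Finset.univ.erase i, α j :=
      Finset.sum_le_sum fun l _ => hj l
    rw [← Finset.add_sum_erase _ _ (Finset.mem_univ i)] at hsum
    rw [Finset.sum_const, Finset.card_erase_of_mem (Finset.mem_univ i), Finset.card_fin,
      Nat.add_sub_cancel, nsmul_eq_mul] at h1
    lia
  · rw [min_eq_right h] at hdeg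
    obtain ⟨i, hi⟩ := hentry (c := (s + 1).toNat + 1) (by
      zify
      rw [Int.toNat_of_nonneg (by lia)]
      convert hdeg using 2
      ring)
    refine sum_ne_zero_of_card_level_le α (s + 1).toNat (α j) hjpos hj ?_ i
      (by exact_mod_cast hi) hsum
    exact card_level_le_of_adeg_nonpos hd hG
      ((ringKrullDim_quotient_jacobianIdeal_substGL_le g F).trans hsing) α hneg
end

section
/- Let α = (α_0,…,α_N) ∈ ℤ^{N+1} \ {0} satisfy α_0 ≤ ⋯ ≤ α_N and Σ_{i=0}^N α_i = 0, and let u, v ∈ {0,…,N}. Write F = Σ_{i=0}^N X_i·P_i as the unique decomposition in which, for each i, P_i is a homogeneous polynomial of degree d−1 in the variables X_i,…,X_N only. If deg_α F < α_u + (d−1)·α_v, then for every integer i with u ≤ i ≤ N and every monomial X_0^{m_0}⋯X_N^{m_N} occurring in P_i with nonzero coefficient, there exists j with 0 ≤ j < v and m_j > 0 (i.e. the monomial is divisible by some X_j with j < v). -/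
open MvPolynomial

/-- In a decomposition `∑ i, X i * P i` with `P i` only involving the variables `X j`, `i ≤ j`,
the monomials of the different summands do not interfere. -/
theorem coeff_sum_X_mul_add_single {R σ : Type*} [CommSemiring R] [Fintype σ] [LinearOrder σ]
    {P : σ → MvPolynomial σ R} (hP : ∀ i, ∀ m ∈ (P i).support, ∀ j, j < i → m j = 0)
    {i : σ} {m : σ →₀ ℕ} (hm : m ∈ (P i).support) :
    coeff (m + Finsupp.single i 1) (∑ i, X i * P i) = coeff m (P i) := by
  rw [coeff_sum, Finset.sum_eq_single i]
  · rw [add_comm, coeff_X_mul]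
  · intro b _ hb
    rw [coeff_X_mul']
    split_ifs with hs
    · rcases lt_or_gt_of_ne hb with h | h
      · simp [hP i m hm b h, hb] at hs
      · by_contra hc
        have := hP b _ (mem_support_iff.mpr hc) i h
        simp [hb] at this
    · rfl
  · simp

theorem le_adeg {R : Type*} [CommSemiring R] {n : ℕ} (α : Fin n → ℤ)
    {G : MvPolynomial (Fin n) R} {m : Fin n →₀ ℕ} (hm : m ∈ G.support) :
    ∑ i, (m i : ℤ) * α i ≤ adeg α G := by
  rw [adeg, dif_pos ⟨m, hm⟩]
  exact Finset.le_sup' (fun m : Fin n →₀ ℕ => ∑ i, (m i : ℤ) * α i) hm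

/-- Write `F = ∑ i, X_i · P_i` where each `P_i` is homogeneous of degree `d-1` in the
variables `X_i, …, X_N` only. If `deg_α F < α_u + (d-1)·α_v`, then for every `i ≥ u`,
every monomial occurring in `P_i` with nonzero coefficient is divisible by some `X_j`
with `j < v`. -/
theorem monomials_divisible_of_adeg_lt {k : Type*} [Field k] [IsAlgClosed k]
    {N d : ℕ} (hN : 1 ≤ N) (hd : 2 ≤ d)
    (F : MvPolynomial (Fin (N+1)) k) (hF0 : F ≠ 0) (hFhom : F.IsHomogeneous d)
    (α : Fin (N+1) → ℤ) (hα0 : α ≠ 0) (hmono : Monotone α) (hsum : ∑ i, α i = 0)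
    (u v : Fin (N+1))
    (P : Fin (N+1) → MvPolynomial (Fin (N+1)) k)
    (hPhom : ∀ i, (P i).IsHomogeneous (d - 1))
    (hPvar : ∀ i, ∀ m ∈ (P i).support, ∀ j : Fin (N+1), j < i → m j = 0)
    (hFdec : F = ∑ i, MvPolynomial.X i * P i)
    (hdeg : adeg α F < α u + ((d : ℤ) - 1) * α v) :
    ∀ i : Fin (N+1), u ≤ i → ∀ m ∈ (P i).support,
      ∃ j : Fin (N+1), (j : ℕ) < (v : ℕ) ∧ m j ≠ 0 := by
  intro i hi m hm
  by_contra! hv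
  have hmem : m + Finsupp.single i 1 ∈ F.support := by
    rw [mem_support_iff, hFdec, coeff_sum_X_mul_add_single hPvar hm]
    exact mem_support_iff.mp hm
  have hle := le_adeg α hmem
  have hsplit : ∑ j, (((m + Finsupp.single i 1 : Fin (N+1) →₀ ℕ) j : ℕ) : ℤ) * α j =
      ∑ j, (m j : ℤ) * α j + α i := by
    simp [add_mul, Finset.sum_add_distrib, Finsupp.single_apply]
  have hdm : ∑ j, (m j : ℤ) = (d : ℤ) - 1 := by
    have h := (hPhom i).degree_eq_sum_deg_support hm
    rw [← Finset.sum_subset (Finset.subset_univ m.support) (by simp)]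
    have hcast : ((d - 1 : ℕ) : ℤ) = ∑ j ∈ m.support, (m j : ℤ) := by exact_mod_cast h
    omega
  have hlow : ((d : ℤ) - 1) * α v ≤ ∑ j, (m j : ℤ) * α j := by
    rw [← hdm, Finset.sum_mul]
    refine Finset.sum_le_sum fun j _ => ?_
    rcases lt_or_ge j v with hj | hj
    · simp [hv j hj]
    · exact mul_le_mul_of_nonneg_left (hmono hj) (Int.natCast_nonneg _)
  have := hmono hi
  linarith
end
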